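/- Let \(M>0\), \(L>2M\), and \(\omega(x,\rho)=\omega_0(x,\rho)+\sum_{n\ge1}[\omega_0(x+nL,\rho)+\omega_0(x-nL,\rho)+4M/(nL)]\) with \(\omega_0\) the log of the Schwarzschild Ernst potential. Then \(\omega(x,\rho) = \frac{4M}{L}\log\rho + O(1)\) as \(\rho\to\infty\), uniformly in \(x\in[-L/2,L/2]\). -/

import Mathlib

noncomputable def omega0 (M x ρ : ℝ) : ℝ :=
  Real.log
    ((Real.sqrt ((x - M) ^ 2 + ρ ^ 2) + Real.sqrt ((x + M) ^ 2 + ρ ^ 2) - 2 * M) /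
     (Real.sqrt ((x - M) ^ 2 + ρ ^ 2) + Real.sqrt ((x + M) ^ 2 + ρ ^ 2) + 2 * M))

noncomputable def omegaPeriodic (M L x ρ : ℝ) : ℝ :=
  omega0 M x ρ + ∑' n : ℕ,
    (omega0 M (x + (n + 1) * L) ρ + omega0 M (x - (n + 1) * L) ρ + 4 * M / ((n + 1) * L))

theorem aux_sqrt_le (a b ρ : ℝ) :
    Real.sqrt (a ^ 2 + ρ ^ 2) ≤ Real.sqrt (b ^ 2 + ρ ^ 2) + |a - b| := by
  have h0 := Real.sqrt_nonneg (b ^ 2 + ρ ^ 2)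
  have h1 := Real.sq_sqrt (show 0 ≤ b ^ 2 + ρ ^ 2 by positivity)
  have h2 : |b| ≤ Real.sqrt (b ^ 2 + ρ ^ 2) := Real.abs_le_sqrt (by nlinarith [sq_nonneg ρ])
  apply Real.sqrt_le_iff.2
  refine ⟨by positivity, ?_⟩
  have h3 : b * (a - b) ≤ |b| * |a - b| := by
    rw [← abs_mul]; exact le_abs_self _
  have h4 := mul_le_mul_of_nonneg_right h2 (abs_nonneg (a - b))
  have h5 := sq_abs (a - b)
  nlinarith

theorem aux_sqrt_abs (a b ρ : ℝ) :
    |Real.sqrt (a ^ 2 + ρ ^ 2) - Real.sqrt (b ^ 2 + ρ ^ 2)| ≤ |a - b| := by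
  have h1 := aux_sqrt_le a b ρ
  have h2 := aux_sqrt_le b a ρ
  rw [abs_sub_comm b a] at h2
  rw [abs_le]; constructor <;> linarith

theorem aux_inv_sub (s t d : ℝ) (hs : 0 < s) (ht : 0 < t) (h : |s - t| ≤ d) :
    |1 / s - 1 / t| ≤ d / (s * t) := by
  have : 1 / s - 1 / t = (t - s) / (s * t) := by field_simp
  rw [this, abs_div, abs_of_pos (mul_pos hs ht), abs_sub_comm]
  gcongr

theorem aux_log (u : ℝ) (hu : 0 < u) (hu2 : u ≤ 1 / 2) :
    |Real.log ((1 - u) / (1 + u)) + 2 * u| ≤ 4 * u ^ 2 := by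
  have hz : 0 < (1 - u) / (1 + u) := div_pos (by linarith) (by linarith)
  have h1 := Real.log_le_sub_one_of_pos hz
  have h2 := Real.one_sub_inv_le_log_of_pos hz
  have e1 : (1 - u) / (1 + u) - 1 ≤ -2 * u + 2 * u ^ 2 := by
    rw [div_sub_one (by linarith), div_le_iff₀ (by linarith)]
    nlinarith [pow_pos hu 3]
  have e2 : -2 * u - 4 * u ^ 2 ≤ 1 - ((1 - u) / (1 + u))⁻¹ := by
    rw [inv_div, one_sub_div (by linarith), le_div_iff₀ (by linarith)]
    nlinarith [pow_pos hu 2]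
  rw [abs_le]; constructor <;> nlinarith [pow_pos hu 2]

theorem aux_omega0 (M y ρ : ℝ) (hM : 0 < M) (hρ : 4 * M ≤ ρ) :
    |omega0 M y ρ + 2 * M * (1 / Real.sqrt (y ^ 2 + ρ ^ 2))|
      ≤ 20 * M ^ 2 / (Real.sqrt (y ^ 2 + ρ ^ 2)) ^ 2 := by
  unfold omega0
  have a1 := aux_sqrt_abs (y - M) y ρ
  have a2 := aux_sqrt_abs (y + M) y ρ
  have hs : ρ ≤ Real.sqrt (y ^ 2 + ρ ^ 2) := Real.le_sqrt_of_sq_le (by nlinarith [sq_nonneg y])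
  rw [show y - M - y = -M by ring, abs_neg, abs_of_pos hM, abs_le] at a1
  rw [show y + M - y = M by ring, abs_of_pos hM, abs_le] at a2
  set s := Real.sqrt (y ^ 2 + ρ ^ 2)
  set S := Real.sqrt ((y - M) ^ 2 + ρ ^ 2) + Real.sqrt ((y + M) ^ 2 + ρ ^ 2) with hS
  have hSs : s ≤ S := by linarith [a1.1, a2.1]
  have hspos : 0 < s := by linarith
  have hSpos : 0 < S := by linarith
  have hd : |S - 2 * s| ≤ 2 * M := by
    rw [abs_le]; constructor <;> linarith [a1.1, a2.1, a1.2, a2.2]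
  have hu := aux_log (2 * M / S) (by positivity) (by rw [div_le_iff₀ hSpos]; linarith)
  have e : (1 - 2 * M / S) / (1 + 2 * M / S) = (S - 2 * M) / (S + 2 * M) := by
    field_simp
  rw [e] at hu
  have hi := aux_inv_sub S (2 * s) _ hSpos (by linarith) hd
  have e2 : Real.log ((S - 2 * M) / (S + 2 * M)) + 2 * M * (1 / s)
      = (Real.log ((S - 2 * M) / (S + 2 * M)) + 2 * (2 * M / S))
        + (-(4 * M)) * (1 / S - 1 / (2 * s)) := by
    field_simp; ring
  rw [e2]
  refine (abs_add_le _ _).trans ?_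
  rw [abs_mul, abs_neg, abs_of_pos (by linarith : 0 < 4 * M)]
  have b1 : 4 * (2 * M / S) ^ 2 ≤ 16 * M ^ 2 / s ^ 2 := by
    calc 4 * (2 * M / S) ^ 2 ≤ 4 * (2 * M / s) ^ 2 := by gcongr
      _ = _ := by ring
  have b2 : 4 * M * (2 * M / (S * (2 * s))) ≤ 4 * M ^ 2 / s ^ 2 := by
    calc 4 * M * (2 * M / (S * (2 * s))) ≤ 4 * M * (2 * M / (s * (2 * s))) := by gcongr
      _ = _ := by field_simp
  calc _ ≤ 4 * (2 * M / S) ^ 2 + 4 * M * (2 * M / (S * (2 * s))) := by gcongr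
    _ ≤ 16 * M ^ 2 / s ^ 2 + 4 * M ^ 2 / s ^ 2 := add_le_add b1 b2
    _ = _ := by ring

theorem aux_shift (M L z w k ρ : ℝ) (hM : 0 < M) (hL : 0 < L) (hk : 1 ≤ k) (hρ : 4 * M ≤ ρ)
    (hw : |w| = k * L) (hz : |z - w| ≤ L / 2) :
    |omega0 M z ρ + 2 * M * (1 / Real.sqrt ((k * L) ^ 2 + ρ ^ 2))|
      ≤ (80 * M ^ 2 + 2 * M * L) / L ^ 2 / k ^ 2 := by
  have h0 := aux_omega0 M z ρ hM hρ
  have h1 := aux_sqrt_abs z w ρ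
  have hw2 : w ^ 2 = (k * L) ^ 2 := by rw [← hw, sq_abs]
  rw [hw2] at h1
  have hs : ρ ≤ Real.sqrt (z ^ 2 + ρ ^ 2) := Real.le_sqrt_of_sq_le (by nlinarith [sq_nonneg z])
  have ht : k * L ≤ Real.sqrt ((k * L) ^ 2 + ρ ^ 2) :=
    Real.le_sqrt_of_sq_le (by nlinarith [sq_nonneg ρ])
  set s := Real.sqrt (z ^ 2 + ρ ^ 2)
  set t := Real.sqrt ((k * L) ^ 2 + ρ ^ 2)
  have hkL : L ≤ k * L := by nlinarith
  have hkLp : 0 < k * L := by linarith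
  have hd : |s - t| ≤ L / 2 := h1.trans hz
  have hst : t / 2 ≤ s := by
    have := (abs_le.1 hd).1
    linarith
  have htp : 0 < t := by linarith
  have hsp : 0 < s := by linarith
  have hi := aux_inv_sub s t _ hsp htp hd
  have e : omega0 M z ρ + 2 * M * (1 / t)
      = (omega0 M z ρ + 2 * M * (1 / s)) + (-(2 * M)) * (1 / s - 1 / t) := by ring
  rw [e]
  refine (abs_add_le _ _).trans ?_
  rw [abs_mul, abs_neg, abs_of_pos (by linarith : 0 < 2 * M)]
  calc _ ≤ 20 * M ^ 2 / s ^ 2 + 2 * M * (L / 2 / (s * t)) := by gcongr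
    _ ≤ 20 * M ^ 2 / (t / 2) ^ 2 + 2 * M * (L / 2 / ((t / 2) * t)) := by gcongr
    _ = (80 * M ^ 2 + 2 * M * L) / t ^ 2 := by field_simp; ring
    _ ≤ (80 * M ^ 2 + 2 * M * L) / (k * L) ^ 2 := by gcongr
    _ = _ := by field_simp

/-- truncated harmonic term -/
noncomputable def auxC (r : ℝ) (n : ℕ) : ℝ := if n < ⌊r⌋₊ then 1 / ((n : ℝ) + 1) else 0

noncomputable def auxD (r : ℝ) (n : ℕ) : ℝ := 1 / ((n : ℝ) + r) - 1 / ((n : ℝ) + 1 + r)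

theorem auxD_nonneg (r : ℝ) (hr : 0 < r) (n : ℕ) : 0 ≤ auxD r n := by
  unfold auxD
  have : (0 : ℝ) ≤ n := n.cast_nonneg
  rw [sub_nonneg]
  gcongr
  linarith

theorem auxD_sum (r : ℝ) (hr : 0 < r) (N : ℕ) : ∑ n ∈ Finset.range N, auxD r n ≤ 1 / r := by
  have h : ∑ n ∈ Finset.range N, auxD r n = 1 / r - 1 / ((N : ℝ) + r) := by
    induction N with
    | zero => simp
    | succ k ih => rw [Finset.sum_range_succ, ih]; unfold auxD; push_cast; ring
  rw [h]
  have : 0 ≤ 1 / ((N : ℝ) + r) := by positivity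
  linarith

theorem aux_bc (r : ℝ) (hr : 0 < r) (n : ℕ) :
    |1 / ((n : ℝ) + 1) - 1 / Real.sqrt (((n : ℝ) + 1) ^ 2 + r ^ 2) - auxC r n|
      ≤ 4 * r * auxD r n := by
  have hn : (0 : ℝ) ≤ n := n.cast_nonneg
  have hd : 2 * r / (((n : ℝ) + 1) ^ 2 + r ^ 2) ≤ 4 * r * auxD r n := by
    have : 4 * r * auxD r n = 4 * r / (((n : ℝ) + r) * (n + 1 + r)) := by
      unfold auxD; field_simp; ring
    rw [this, div_le_div_iff₀ (by positivity) (by positivity)]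
    nlinarith [mul_nonneg hr.le (sq_nonneg ((n : ℝ) + 1 - r)), mul_nonneg hr.le hn, mul_pos hr hr]
  refine le_trans ?_ hd
  set k : ℝ := (n : ℝ) + 1 with hk
  have hkp : 0 < k := by linarith
  have hq : 0 < k ^ 2 + r ^ 2 := by positivity
  have hsp : 0 < Real.sqrt (k ^ 2 + r ^ 2) := Real.sqrt_pos.2 hq
  have hss := Real.sq_sqrt hq.le
  have hsr : r ≤ Real.sqrt (k ^ 2 + r ^ 2) := Real.le_sqrt_of_sq_le (by nlinarith)
  have hsk : k ≤ Real.sqrt (k ^ 2 + r ^ 2) := Real.le_sqrt_of_sq_le (by nlinarith)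
  unfold auxC
  split_ifs with h
  · have hkr : k ≤ r := by
      have : ((n + 1 : ℕ) : ℝ) ≤ r := (Nat.le_floor_iff hr.le).1 h
      push_cast at this; exact this
    rw [show 1 / k - 1 / Real.sqrt (k ^ 2 + r ^ 2) - 1 / ((n : ℝ) + 1)
      = -(1 / Real.sqrt (k ^ 2 + r ^ 2)) by rw [hk]; ring, abs_neg, abs_of_pos (by positivity)]
    calc 1 / Real.sqrt (k ^ 2 + r ^ 2) ≤ 1 / r := by gcongr
      _ ≤ _ := by rw [div_le_div_iff₀ hr hq]; nlinarith
  · have hkr : r ≤ k := by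
      have := Nat.lt_floor_add_one r
      have h2 : (⌊r⌋₊ : ℝ) ≤ n := by exact_mod_cast not_lt.1 h
      linarith
    rw [sub_zero, abs_of_nonneg (by rw [sub_nonneg]; gcongr)]
    set s := Real.sqrt (k ^ 2 + r ^ 2)
    rw [← hss]
    rw [div_sub_div _ _ hkp.ne' hsp.ne', div_le_div_iff₀ (by positivity) (by positivity)]
    have h1 : (s - k) * (s + k) = r ^ 2 := by nlinarith
    have h2 : (s - k) * s ≤ r * k := by nlinarith
    nlinarith [mul_le_mul_of_nonneg_right h2 hsp.le, mul_pos (mul_pos hr hkp) hsp]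

theorem auxC_hasSum (r : ℝ) : HasSum (auxC r) ((harmonic ⌊r⌋₊ : ℚ) : ℝ) := by
  have h : ((harmonic ⌊r⌋₊ : ℚ) : ℝ) = ∑ n ∈ Finset.range ⌊r⌋₊, auxC r n := by
    rw [harmonic]; push_cast
    refine Finset.sum_congr rfl fun n hn => ?_
    rw [auxC, if_pos (Finset.mem_range.1 hn), one_div]
  rw [h]
  refine hasSum_sum_of_ne_finset_zero fun n hn => ?_
  rw [auxC, if_neg (by simpa using hn)]

/-- Theorem 4 of the paper (Kasner asymptotics): `ω(x,ρ) = (4M/L) log ρ + O(1)` as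
`ρ → ∞`, uniformly in `x ∈ [-L/2, L/2]`. -/
theorem omegaPeriodic_kasner_asymptotics (M L : ℝ) (hM : 0 < M) (hL : 2 * M < L) :
    ∃ C R : ℝ, 0 < C ∧ 0 < R ∧ ∀ x ρ : ℝ, |x| ≤ L / 2 → R ≤ ρ →
      |omegaPeriodic M L x ρ - (4 * M / L) * Real.log ρ| ≤ C := by
  have hLp : 0 < L := by linarith
  set K := (80 * M ^ 2 + 2 * M * L) / L ^ 2 with hK
  have hKp : 0 < K := by positivity
  have hsumm : Summable fun n : ℕ => 1 / ((n : ℝ) + 1) ^ 2 := by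
    have := (summable_nat_add_iff 1).2 (Real.summable_one_div_nat_pow.2 one_lt_two)
    simpa using this
  set Z := ∑' n : ℕ, 1 / ((n : ℝ) + 1) ^ 2 with hZ
  have hZ0 : 0 ≤ Z := tsum_nonneg fun n => by positivity
  refine ⟨2 + (4 * M / L * 4 + 2 * K * Z) + 4 * M / L * (1 + |Real.log L|), 4 * M + L,
    by positivity, by positivity, ?_⟩
  intro x ρ hx hρ
  have hρM : 4 * M ≤ ρ := by linarith
  have hρp : 0 < ρ := by linarith
  set r := ρ / L with hr
  have hr1 : 1 ≤ r := by rw [hr, le_div_iff₀ hLp]; linarith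
  have hrp : 0 < r := by linarith
  -- the n = 0 term
  have h0 : |omega0 M x ρ| ≤ 2 := by
    have h := aux_omega0 M x ρ hM hρM
    have hs : ρ ≤ Real.sqrt (x ^ 2 + ρ ^ 2) := Real.le_sqrt_of_sq_le (by nlinarith [sq_nonneg x])
    set s := Real.sqrt (x ^ 2 + ρ ^ 2)
    have hsM : 4 * M ≤ s := by linarith
    have hsp : 0 < s := by linarith
    have e1 : 20 * M ^ 2 / s ^ 2 ≤ 20 / 16 := by
      rw [div_le_div_iff₀ (by positivity) (by norm_num)]; nlinarith
    have e2 : 2 * M * (1 / s) ≤ 1 / 2 := by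
      rw [mul_one_div, div_le_div_iff₀ hsp (by norm_num)]; linarith
    have e3 : 0 < 2 * M * (1 / s) := by positivity
    rw [abs_le] at h ⊢
    constructor <;> linarith [h.1, h.2]
  set f : ℕ → ℝ := fun n =>
    omega0 M (x + (n + 1) * L) ρ + omega0 M (x - (n + 1) * L) ρ + 4 * M / ((n + 1) * L) with hf
  set g : ℕ → ℝ := fun n => 4 * M / L * (4 * r * auxD r n) + 2 * K * (1 / ((n : ℝ) + 1) ^ 2) with hg
  have hfg : ∀ n, |f n - 4 * M / L * auxC r n| ≤ g n := by
    intro n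
    have hn : (0 : ℝ) ≤ n := n.cast_nonneg
    have a1 := aux_shift M L (x + (n + 1) * L) ((n + 1) * L) (n + 1) ρ hM hLp (by linarith) hρM
      (abs_of_nonneg (by positivity)) (by simpa using hx)
    have a2 := aux_shift M L (x - (n + 1) * L) (-((n + 1) * L)) (n + 1) ρ hM hLp (by linarith) hρM
      (by rw [abs_neg]; exact abs_of_nonneg (by positivity)) (by simpa using hx)
    have a3 := aux_bc r hrp n
    have et : Real.sqrt ((((n : ℝ) + 1) * L) ^ 2 + ρ ^ 2)
        = L * Real.sqrt (((n : ℝ) + 1) ^ 2 + r ^ 2) := by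
      rw [show (((n : ℝ) + 1) * L) ^ 2 + ρ ^ 2 = L ^ 2 * (((n : ℝ) + 1) ^ 2 + r ^ 2) by
        rw [hr]; field_simp, Real.sqrt_mul (by positivity), Real.sqrt_sq hLp.le]
    rw [et] at a1 a2
    have hsp : 0 < Real.sqrt (((n : ℝ) + 1) ^ 2 + r ^ 2) := Real.sqrt_pos.2 (by positivity)
    set t := Real.sqrt (((n : ℝ) + 1) ^ 2 + r ^ 2)
    have e : f n - 4 * M / L * auxC r n
        = (omega0 M (x + (n + 1) * L) ρ + 2 * M * (1 / (L * t)))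
          + (omega0 M (x - (n + 1) * L) ρ + 2 * M * (1 / (L * t)))
          + 4 * M / L * (1 / ((n : ℝ) + 1) - 1 / t - auxC r n) := by
      simp only [hf]; field_simp; ring
    rw [e]
    refine (abs_add_le _ _).trans ?_
    have a4 := abs_add_le (omega0 M (x + (n + 1) * L) ρ + 2 * M * (1 / (L * t)))
      (omega0 M (x - (n + 1) * L) ρ + 2 * M * (1 / (L * t)))
    have hc : 0 < 4 * M / L := by positivity
    rw [abs_mul, abs_of_pos hc]
    have a5 := mul_le_mul_of_nonneg_left a3 hc.le
    have e6 : g n = 4 * M / L * (4 * r * auxD r n) + K / ((n : ℝ) + 1) ^ 2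
        + K / ((n : ℝ) + 1) ^ 2 := by simp only [hg]; ring
    rw [e6]
    linarith
  have hDs : Summable (auxD r) :=
    summable_of_sum_range_le (auxD_nonneg r hrp) (auxD_sum r hrp)
  have hDt : ∑' n, auxD r n ≤ 1 / r :=
    Real.tsum_le_of_sum_range_le (auxD_nonneg r hrp) (auxD_sum r hrp)
  have hgs : HasSum g (4 * M / L * (4 * r * ∑' n, auxD r n) + 2 * K * Z) :=
    ((hDs.hasSum.mul_left _).mul_left _).add (hsumm.hasSum.mul_left _)
  have hEs : Summable fun n => f n - 4 * M / L * auxC r n :=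
    Summable.of_norm_bounded hgs.summable hfg
  have hEb : |∑' n, (f n - 4 * M / L * auxC r n)| ≤ 4 * M / L * 4 + 2 * K * Z := by
    refine (tsum_of_norm_bounded (f := fun n => f n - 4 * M / L * auxC r n) hgs hfg).trans ?_
    have : 4 * r * ∑' n, auxD r n ≤ 4 := by
      calc 4 * r * ∑' n, auxD r n ≤ 4 * r * (1 / r) := by gcongr
        _ = 4 := by field_simp
    gcongr
  have hcs := (auxC_hasSum r).mul_left (4 * M / L)
  have hft : ∑' n, f n = ∑' n, (f n - 4 * M / L * auxC r n)
      + 4 * M / L * ((harmonic ⌊r⌋₊ : ℚ) : ℝ) := by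
    have := (hEs.hasSum.add hcs).tsum_eq
    rw [← this]
    exact tsum_congr fun n => by ring
  have hH : |((harmonic ⌊r⌋₊ : ℚ) : ℝ) - Real.log r| ≤ 1 := by
    have h1 := log_le_harmonic_floor r hrp.le
    have h2 := harmonic_floor_le_one_add_log r hr1
    rw [abs_le]; constructor <;> linarith
  have hlog : Real.log r = Real.log ρ - Real.log L := Real.log_div hρp.ne' hLp.ne'
  have hω : omegaPeriodic M L x ρ = omega0 M x ρ + ∑' n, f n := rfl
  have hfin : omegaPeriodic M L x ρ - 4 * M / L * Real.log ρ
      = omega0 M x ρ + ∑' n, (f n - 4 * M / L * auxC r n)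
        + 4 * M / L * ((((harmonic ⌊r⌋₊ : ℚ) : ℝ) - Real.log r) + -Real.log L) := by
    rw [hω, hft, hlog]; ring
  rw [hfin]
  refine (abs_add_le _ _).trans ?_
  refine add_le_add ((abs_add_le _ _).trans (add_le_add h0 hEb)) ?_
  rw [abs_mul, abs_of_pos (show 0 < 4 * M / L by positivity)]
  gcongr
  refine (abs_add_le _ _).trans ?_
  rw [abs_neg]
  gcongr
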